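/- arXiv:1409.0341 — 2 statements merged into one kernel-verified Lean document; each statement's English description precedes it below -/
import Mathlib

section
/- Let d ≥ 2, let 1/d³ ≤ a ≤ 1/d², and let {ρ_x}_{x=1}^{d²} be a d-dimensional arbitrary-rank SIC set: each ρ_x is a positive semidefinite d×d complex matrix with Tr[ρ_x] = 1, Σ_x ρ_x = d·I, and Tr[ρ_x ρ_{x'}] = d²a if x = x' and d(1 − da)/(d² − 1) if x ≠ x'. Let E = {(1/d²)ρ_x} be the associated arbitrary-rank SIC ensemble. Then for every POVM Q in dimension d, the mutual information satisfies I(E, Q) ≤ log₂( d(d²a + 1)/(d+1) ); i.e., the accessible information of any arbitrary-rank SIC ensemble is at most log₂( d(d²a + 1)/(d+1) ). -/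
open Matrix Finset
open scoped BigOperators ComplexOrder

/-- The mutual information (in bits) of a finite joint probability distribution
`p : X → Y → ℝ`, with the convention `0·log₂ 0 = 0` (terms with `p x y = 0` vanish). -/
noncomputable def mutualInfo {X Y : Type*} [Fintype X] [Fintype Y] (p : X → Y → ℝ) : ℝ :=
  ∑ x, ∑ y, p x y * Real.logb 2 (p x y / ((∑ y', p x y') * (∑ x', p x' y)))

/-- `ρ` is a `d`-dimensional arbitrary-rank SIC set with parameter `a`:
`d²` unit-trace PSD matrices summing to `d·I` whose pairwise Hilbert-Schmidt inner
products are `d²a` on the diagonal and `d(1−da)/(d²−1)` off the diagonal. -/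
noncomputable def IsGenSIC (d : ℕ) (a : ℝ) (ρ : Fin (d ^ 2) → Matrix (Fin d) (Fin d) ℂ) :
    Prop :=
  (∀ x, (ρ x).PosSemidef) ∧ (∀ x, (ρ x).trace = 1) ∧
  (∑ x, ρ x = (d : ℂ) • 1) ∧
  (∀ x x', (ρ x * ρ x').trace =
    if x = x' then ((d : ℂ) ^ 2 * (a : ℂ))
    else ((d : ℂ) * (1 - (d : ℂ) * (a : ℂ)) / ((d : ℂ) ^ 2 - 1)))


/-- The mutual information is at most the logarithm of the mean likelihood ratio. -/
theorem mutualInfo_le_logb {X Y : Type*} [Fintype X] [Fintype Y] {p : X → Y → ℝ} {K : ℝ}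
    (hp : ∀ x y, 0 ≤ p x y) (hsum : ∑ x, ∑ y, p x y = 1) (hK : 0 < K)
    (hbound : ∑ x, ∑ y, p x y * (p x y / ((∑ y', p x y') * (∑ x', p x' y))) ≤ K) :
    mutualInfo p ≤ Real.logb 2 K := by
  have hlog2 : 0 < Real.log 2 := Real.log_pos one_lt_two
  have term (x : X) (y : Y) :
      p x y * Real.logb 2 (p x y / ((∑ y', p x y') * (∑ x', p x' y))) * Real.log 2 ≤
        p x y * (p x y / ((∑ y', p x y') * (∑ x', p x' y))) * K⁻¹
          + p x y * (Real.log K - 1) := by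
    rcases (hp x y).eq_or_lt with h | h
    · simp [← h]
    have hx : 0 < ∑ y', p x y' :=
      h.trans_le (single_le_sum (f := fun y' => p x y') (fun _ _ => hp _ _) (mem_univ y))
    have hy : 0 < ∑ x', p x' y :=
      h.trans_le (single_le_sum (f := fun x' => p x' y) (fun _ _ => hp _ _) (mem_univ x))
    set r := p x y / ((∑ y', p x y') * (∑ x', p x' y)) with hr
    have hrpos : 0 < r := by positivity
    have hle := Real.log_le_sub_one_of_pos (div_pos hrpos hK)
    rw [Real.log_div hrpos.ne' hK.ne', div_eq_mul_inv] at hle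
    rw [Real.logb, mul_assoc, div_mul_cancel₀ _ hlog2.ne']
    nlinarith
  have total : mutualInfo p * Real.log 2 ≤ Real.log K := by
    calc mutualInfo p * Real.log 2
        = ∑ x, ∑ y, p x y * Real.logb 2 (p x y / ((∑ y', p x y') * (∑ x', p x' y)))
            * Real.log 2 := by simp only [mutualInfo, sum_mul]
      _ ≤ ∑ x, ∑ y, (p x y * (p x y / ((∑ y', p x y') * (∑ x', p x' y))) * K⁻¹
            + p x y * (Real.log K - 1)) :=
          sum_le_sum fun x _ => sum_le_sum fun y _ => term x y
      _ = (∑ x, ∑ y, p x y * (p x y / ((∑ y', p x y') * (∑ x', p x' y)))) * K⁻¹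
            + (∑ x, ∑ y, p x y) * (Real.log K - 1) := by
          simp only [sum_add_distrib, sum_mul]
      _ ≤ K * K⁻¹ + 1 * (Real.log K - 1) := by
          rw [hsum]
          gcongr
      _ = Real.log K := by rw [mul_inv_cancel₀ hK.ne']; ring
  rwa [Real.logb, le_div_iff₀ hlog2]

section TraceForm

variable {n : Type*} [Fintype n]

/-- The real bilinear form `(A, B) ↦ Re Tr[A B]` on complex matrices. -/
noncomputable def traceReForm : Matrix n n ℂ →ₗ[ℝ] Matrix n n ℂ →ₗ[ℝ] ℝ :=
  LinearMap.mk₂ ℝ (fun A B => (A * B).trace.re)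
    (by intros; simp [add_mul]) (by intros; simp)
    (by intros; simp [mul_add]) (by intros; simp)

theorem traceReForm_apply (A B : Matrix n n ℂ) : traceReForm A B = (A * B).trace.re := rfl

theorem traceReForm_comm (A B : Matrix n n ℂ) : traceReForm A B = traceReForm B A := by
  rw [traceReForm_apply, traceReForm_apply, Matrix.trace_mul_comm]

theorem traceReForm_self_nonneg {A : Matrix n n ℂ} (hA : A.IsHermitian) :
    0 ≤ traceReForm A A := by
  have h := (posSemidef_conjTranspose_mul_self A).trace_nonneg
  rw [hA.eq] at h
  exact (Complex.le_def.mp h).1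

theorem traceReForm_nonneg {A B : Matrix n n ℂ} (hA : A.PosSemidef) (hB : B.PosSemidef) :
    0 ≤ traceReForm A B := by
  obtain ⟨m, v, rfl⟩ := Matrix.posSemidef_iff_eq_sum_vecMulVec.mp hB
  rw [map_sum]
  refine sum_nonneg fun i _ => ?_
  rw [traceReForm_apply, Matrix.mul_vecMulVec, Matrix.trace_vecMulVec, dotProduct_comm]
  exact (Complex.le_def.mp (hA.dotProduct_mulVec_nonneg (v i))).1

theorem traceReForm_self_le_trace_sq {A : Matrix n n ℂ} (hA : A.PosSemidef) :
    traceReForm A A ≤ A.trace.re ^ 2 := by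
  classical
  have hsq : traceReForm A A = ∑ i, hA.1.eigenvalues i ^ 2 := by
    have h := hA.1.spectral_theorem
    rw [traceReForm_apply]
    conv_lhs => rw [h]
    rw [← map_mul, Unitary.conjStarAlgAut_apply, Matrix.trace_mul_cycle]
    simp [Matrix.diagonal_mul_diagonal, Matrix.trace_diagonal, sq]
  have htr : A.trace.re = ∑ i, hA.1.eigenvalues i := by
    rw [hA.1.trace_eq_sum_eigenvalues]
    simp
  rw [hsq, htr]
  exact sum_sq_le_sq_sum_of_nonneg fun i _ => hA.eigenvalues_nonneg i

end TraceForm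

/-- The frame bound for arbitrary-rank SIC sets. -/
theorem IsGenSIC.sum_traceReForm_sq_le {d : ℕ} (hd : 2 ≤ d) {a : ℝ} (ha : 1 / (d : ℝ) ^ 3 ≤ a)
    {ρ : Fin (d ^ 2) → Matrix (Fin d) (Fin d) ℂ} (hρ : IsGenSIC d a ρ)
    {A : Matrix (Fin d) (Fin d) ℂ} (hA : A.PosSemidef) :
    ∑ x, traceReForm (ρ x) A ^ 2 ≤
      (d : ℝ) * ((d : ℝ) ^ 2 * a + 1) / ((d : ℝ) + 1) * A.trace.re ^ 2 := by
  obtain ⟨hpsd, htr, hsum, hgram⟩ := hρ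
  have hd2 : (2 : ℝ) ≤ d := by exact_mod_cast hd
  have hd0 : (0 : ℝ) < d := by linarith
  have hden : (0 : ℝ) < (d : ℝ) ^ 2 - 1 := by nlinarith
  set D : ℝ := (d : ℝ) with hD
  set b : ℝ := D * (1 - D * a) / (D ^ 2 - 1) with hb
  set l : ℝ := D ^ 2 * a - b with hl
  set t : ℝ := A.trace.re with ht
  set S : ℝ := ∑ x, traceReForm (ρ x) A ^ 2 with hS
  set N : ℝ := traceReForm A A with hN
  have hl_eq : l = (D ^ 4 * a - D) / (D ^ 2 - 1) := by
    rw [hl, hb]; field_simp; ring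
  have hl0 : 0 ≤ l := by
    rw [hl_eq]
    apply div_nonneg _ hden.le
    rw [div_le_iff₀ (by positivity)] at ha
    nlinarith
  have hbl : b * D ^ 2 = D - l := by
    rw [hl, hb]; field_simp; ring
  have hG (x x' : Fin (d ^ 2)) :
      traceReForm (ρ x) (ρ x') = (if x = x' then l else 0) + b := by
    rw [traceReForm_apply, hgram]
    split_ifs
    · rw [hl, sub_add_cancel, hD]
      exact_mod_cast rfl
    · rw [zero_add, hb, hD]
      norm_cast
  have hone : traceReForm (1 : Matrix (Fin d) (Fin d) ℂ) 1 = D := by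
    simp [traceReForm_apply, hD]
  have h1A : traceReForm 1 A = t := by simp [traceReForm_apply, ht]
  have hρ1 (x) : traceReForm (ρ x) 1 = 1 := by simp [traceReForm_apply, htr]
  have hcsum : ∑ x, traceReForm (ρ x) A = D * t := by
    rw [← LinearMap.sum_apply, ← map_sum, hsum, traceReForm_apply]
    simp [ht, hD]
  have quad (μ : ℝ) : 0 ≤ μ ^ 2 * (N - t ^ 2 / D) + (l - 2 * μ) * (S - t ^ 2) := by
    set ν : ℝ := t * (D - μ) / D with hν
    set R : Matrix (Fin d) (Fin d) ℂ := ∑ x, traceReForm (ρ x) A • ρ x with hR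
    have hRA : traceReForm R A = S := by
      simp [hR, hS, LinearMap.sum_apply, sq]
    have hR1 : traceReForm R 1 = D * t := by
      simp [hR, LinearMap.sum_apply, hρ1, hcsum]
    have hRR : traceReForm R R = l * S + b * (D * t) ^ 2 := by
      rw [← hcsum, hS, sq (∑ x, traceReForm (ρ x) A), Finset.sum_mul_sum]
      simp only [hR, LinearMap.sum_apply, map_sum, map_smul, LinearMap.smul_apply, smul_eq_mul,
        hG, mul_add, sum_add_distrib, mul_sum, mul_ite, mul_zero, sum_ite_eq',
        mem_univ, if_true]
      congr 1
      · exact sum_congr rfl fun x _ => by ring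
      · exact sum_congr rfl fun x _ => sum_congr rfl fun y _ => by ring
    have hRherm : R.IsHermitian := by
      rw [Matrix.IsHermitian, hR, Matrix.conjTranspose_sum]
      exact sum_congr rfl fun x _ => by
        rw [Matrix.conjTranspose_smul, (hpsd x).1.eq, star_trivial]
    have hM : (μ • A + ν • 1 - R).IsHermitian := by
      rw [Matrix.IsHermitian, Matrix.conjTranspose_sub, Matrix.conjTranspose_add,
        Matrix.conjTranspose_smul, Matrix.conjTranspose_smul, hA.1.eq, hRherm.eq,
        Matrix.conjTranspose_one, star_trivial, star_trivial]
    have h := traceReForm_self_nonneg hM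
    simp only [map_add, map_sub, map_smul, LinearMap.add_apply, LinearMap.sub_apply,
      LinearMap.smul_apply, smul_eq_mul, traceReForm_comm A 1, traceReForm_comm A R,
      traceReForm_comm 1 R, hRA, hR1, hRR, hone, h1A, ← hN] at h
    refine h.trans_eq ?_
    have : b * (D * t) ^ 2 = (D - l) * t ^ 2 := by rw [← hbl]; ring
    rw [this, hν]
    field_simp
    ring
  have frame : S - t ^ 2 ≤ l * (N - t ^ 2 / D) := by
    rcases hl0.eq_or_lt with h0 | hpos
    · rw [← h0, zero_mul]
      by_contra! hs
      have hpos : 0 < |N - t ^ 2 / D| + 1 := by positivity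
      have h := quad ((S - t ^ 2) / (|N - t ^ 2 / D| + 1))
      rw [← h0] at h
      have hle := le_abs_self (N - t ^ 2 / D)
      set E := N - t ^ 2 / D
      set s := S - t ^ 2
      have heq : (s / (|E| + 1)) ^ 2 * E + (0 - 2 * (s / (|E| + 1))) * s
          = (s / (|E| + 1)) ^ 2 * (E - 2 * (|E| + 1)) := by
        field_simp
        ring
      rw [heq] at h
      have : 0 < (s / (|E| + 1)) ^ 2 := by positivity
      nlinarith
    · have h := quad l
      have : 0 ≤ l * (l * (N - t ^ 2 / D) - (S - t ^ 2)) := by linarith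
      linarith [nonneg_of_mul_nonneg_right this hpos]
  have hNt : N ≤ t ^ 2 := traceReForm_self_le_trace_sq hA
  calc S ≤ t ^ 2 + l * (t ^ 2 - t ^ 2 / D) := by nlinarith
    _ = D * (D ^ 2 * a + 1) / (D + 1) * t ^ 2 := by
      rw [hl_eq]
      have : D ^ 2 - 1 = (D - 1) * (D + 1) := by ring
      have h1 : D - 1 ≠ 0 := by linarith
      rw [this]
      field_simp
      ring

/-- Accessible information bound for arbitrary-rank SIC ensembles: for the ensemble
`E = {(1/d²)ρ_x}` and any POVM `{Π_y}`, the mutual information satisfies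
`I(E,Q) ≤ log₂(d(d²a + 1)/(d+1))`. -/
theorem accessible_information_bound_gen_sic {d : ℕ} (hd : 2 ≤ d) (a : ℝ)
    (ha1 : 1 / (d : ℝ) ^ 3 ≤ a) (ha2 : a ≤ 1 / (d : ℝ) ^ 2)
    (ρ : Fin (d ^ 2) → Matrix (Fin d) (Fin d) ℂ) (hρ : IsGenSIC d a ρ)
    {m : ℕ} (Q : Fin m → Matrix (Fin d) (Fin d) ℂ)
    (hQpsd : ∀ y, (Q y).PosSemidef) (hQsum : ∑ y, Q y = 1) :
    mutualInfo (fun x y => ((((d : ℂ) ^ 2)⁻¹ • ρ x) * Q y).trace.re)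
      ≤ Real.logb 2 ((d : ℝ) * ((d : ℝ) ^ 2 * a + 1) / ((d : ℝ) + 1)) := by
  have hdR : (0 : ℝ) < d := by exact_mod_cast (by omega : 0 < d)
  have hp_eq (x : Fin (d ^ 2)) (y : Fin m) :
      ((((d : ℂ) ^ 2)⁻¹ • ρ x) * Q y).trace.re
        = ((d : ℝ) ^ 2)⁻¹ * traceReForm (ρ x) (Q y) := by
    rw [traceReForm_apply, Matrix.smul_mul, Matrix.trace_smul, smul_eq_mul,
      ← Complex.re_ofReal_mul]
    push_cast
    rfl
  simp only [hp_eq]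
  have hsic := hρ
  obtain ⟨hpsd, htr, hsum, -⟩ := hρ
  have hrow (x) : ∑ y, ((d : ℝ) ^ 2)⁻¹ * traceReForm (ρ x) (Q y) = ((d : ℝ) ^ 2)⁻¹ := by
    rw [← mul_sum, ← map_sum, hQsum, traceReForm_apply, mul_one, htr]
    simp
  have hcol (y) : ∑ x, ((d : ℝ) ^ 2)⁻¹ * traceReForm (ρ x) (Q y)
      = (d : ℝ)⁻¹ * (Q y).trace.re := by
    rw [← mul_sum, ← LinearMap.sum_apply, ← map_sum, hsum, traceReForm_apply]
    simp
    field_simp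
  have hQtr : ∑ y, (Q y).trace.re = d := by
    rw [← Complex.re_sum, ← Matrix.trace_sum, hQsum]
    simp
  have ha : 0 ≤ a := le_trans (by positivity) ha1
  refine mutualInfo_le_logb ?_ ?_ (by positivity) ?_
  · exact fun x y => mul_nonneg (by positivity) (traceReForm_nonneg (hpsd x) (hQpsd y))
  · simp only [hrow]
    simp [hdR.ne']
  · simp only [hrow, hcol]
    rw [sum_comm]
    set K : ℝ := (d : ℝ) * ((d : ℝ) ^ 2 * a + 1) / ((d : ℝ) + 1)
    calc _ ≤ ∑ y, K * (d : ℝ)⁻¹ * (Q y).trace.re := sum_le_sum fun y _ => ?_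
      _ = K := by rw [← mul_sum, hQtr]; field_simp
    have ht : 0 ≤ (Q y).trace.re := (Complex.le_def.mp (hQpsd y).trace_nonneg).1
    have hframe := hsic.sum_traceReForm_sq_le hd ha1 (hQpsd y)
    rcases ht.eq_or_lt with h0 | hpos
    · simp [← h0]
    calc _ = (d : ℝ)⁻¹ * (Q y).trace.re⁻¹ * ∑ x, traceReForm (ρ x) (Q y) ^ 2 := by
          rw [mul_sum]
          exact sum_congr rfl fun x _ => by field_simp
      _ ≤ (d : ℝ)⁻¹ * (Q y).trace.re⁻¹ * (K * (Q y).trace.re ^ 2) := by gcongr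
      _ = K * (d : ℝ)⁻¹ * (Q y).trace.re := by field_simp
end

section
/- Let E be the ensemble in dimension 4 consisting of the 20 states (1/20)|φ_x⟩⟨φ_x|, where the φ_x are the unit vectors e₁, e₂, e₃, e₄ and (1/2)(1,1,1,1), (1/2)(1,1,−1,−1), (1/2)(1,−1,−1,1), (1/2)(1,−1,1,−1), (1/2)(1,−1,−i,−i), (1/2)(1,−1,i,i), (1/2)(1,1,i,−i), (1/2)(1,1,−i,i), (1/2)(1,−i,−i,−1), (1/2)(1,−i,i,1), (1/2)(1,i,i,−1), (1/2)(1,i,−i,1), (1/2)(1,−i,−1,−i), (1/2)(1,−i,1,i), (1/2)(1,i,−1,i), (1/2)(1,i,1,−i) (the 4-dimensional 5-MUB ensemble), and let P be the POVM consisting of the 20 effects (1/5)|φ_x⟩⟨φ_x| (the 5-MUB POVM). Let Q be the projective POVM with effects |q_y⟩⟨q_y| for the orthonormal vectors q₁ = (1/√2, i/√2, 0, 0), q₂ = (1/2, −i/2, −i/2, 1/2), q₃ = (0, 0, i/√2, 1/√2), q₄ = (1/2, −i/2, i/2, −1/2), and let F be the ensemble {(1/4)|q_y⟩⟨q_y|}.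 Then the mutual informations equal exactly I(E, Q) = I(F, P) = 3/5 bits. -/
open Matrix Finset Complex
open scoped BigOperators ComplexOrder

/-- The rank-one operator `|φ⟩⟨φ|` associated to a vector `φ : Fin d → ℂ`. -/
noncomputable def outerProd {d : ℕ} (φ : Fin d → ℂ) : Matrix (Fin d) (Fin d) ℂ :=
  Matrix.vecMulVec φ (star φ)

/-- The 20 unit vectors of the (unique) maximal set of 5 mutually unbiased bases in
dimension 4. -/
noncomputable def mub4Vecs : Fin 20 → Fin 4 → ℂ :=
  ![![1, 0, 0, 0], ![0, 1, 0, 0], ![0, 0, 1, 0], ![0, 0, 0, 1],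
    (2 : ℂ)⁻¹ • ![1, 1, 1, 1],
    (2 : ℂ)⁻¹ • ![1, 1, -1, -1],
    (2 : ℂ)⁻¹ • ![1, -1, -1, 1],
    (2 : ℂ)⁻¹ • ![1, -1, 1, -1],
    (2 : ℂ)⁻¹ • ![1, -1, -I, -I],
    (2 : ℂ)⁻¹ • ![1, -1, I, I],
    (2 : ℂ)⁻¹ • ![1, 1, I, -I],
    (2 : ℂ)⁻¹ • ![1, 1, -I, I],
    (2 : ℂ)⁻¹ • ![1, -I, -I, -1],
    (2 : ℂ)⁻¹ • ![1, -I, I, 1],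
    (2 : ℂ)⁻¹ • ![1, I, I, -1],
    (2 : ℂ)⁻¹ • ![1, I, -I, 1],
    (2 : ℂ)⁻¹ • ![1, -I, -1, -I],
    (2 : ℂ)⁻¹ • ![1, -I, 1, I],
    (2 : ℂ)⁻¹ • ![1, I, -1, I],
    (2 : ℂ)⁻¹ • ![1, I, 1, -I]]

/-- The 4 orthonormal vectors of the conjectured optimal orthonormal measurement and
ensemble for the 4-dimensional 5-MUB. -/
noncomputable def ortho4Vecs : Fin 4 → Fin 4 → ℂ :=
  ![![((Real.sqrt 2 : ℂ))⁻¹, I * ((Real.sqrt 2 : ℂ))⁻¹, 0, 0],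
    ![(2 : ℂ)⁻¹, -I * (2 : ℂ)⁻¹, -I * (2 : ℂ)⁻¹, (2 : ℂ)⁻¹],
    ![0, 0, I * ((Real.sqrt 2 : ℂ))⁻¹, ((Real.sqrt 2 : ℂ))⁻¹],
    ![(2 : ℂ)⁻¹, -I * (2 : ℂ)⁻¹, I * (2 : ℂ)⁻¹, -(2 : ℂ)⁻¹]]

/-- Four times the squared overlaps `|⟨φ_x|q_y⟩|²`. -/
def overlapTable : Fin 20 → Fin 4 → ℕ :=
  ![![2, 1, 0, 1], ![2, 1, 0, 1], ![0, 1, 2, 1], ![0, 1, 2, 1],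
    ![1, 2, 1, 0], ![1, 0, 1, 2], ![1, 2, 1, 0], ![1, 0, 1, 2],
    ![1, 2, 1, 0], ![1, 0, 1, 2], ![1, 0, 1, 2], ![1, 2, 1, 0],
    ![0, 1, 2, 1], ![0, 1, 2, 1], ![2, 1, 0, 1], ![2, 1, 0, 1],
    ![0, 2, 0, 2], ![0, 2, 0, 2], ![2, 0, 2, 0], ![2, 0, 2, 0]]

theorem trace_outerProd_mul_outerProd {d : ℕ} (a b : Fin d → ℂ) :
    (outerProd a * outerProd b).trace = (star a ⬝ᵥ b) * (star b ⬝ᵥ a) := by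
  rw [outerProd, outerProd, Matrix.vecMulVec_mul_vecMulVec, Matrix.trace_vecMulVec,
    dotProduct_smul, smul_eq_mul, dotProduct_comm a]

set_option maxHeartbeats 2000000 in
theorem trace_mub4_ortho4 (x : Fin 20) (y : Fin 4) :
    (outerProd (mub4Vecs x) * outerProd (ortho4Vecs y)).trace = (overlapTable x y : ℂ) / 4 := by
  have hs : ((Real.sqrt 2 : ℂ))⁻¹ ^ 2 = 1 / 2 := by
    rw [inv_pow, ← Complex.ofReal_pow, Real.sq_sqrt zero_le_two]
    norm_num
  have hc : (starRingEnd ℂ) ((Real.sqrt 2 : ℂ))⁻¹ = ((Real.sqrt 2 : ℂ))⁻¹ := by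
    rw [map_inv₀, Complex.conj_ofReal]
  have h2 : (starRingEnd ℂ) 2 = 2 := Complex.conj_ofNat 2
  rw [trace_outerProd_mul_outerProd]
  unfold mub4Vecs ortho4Vecs overlapTable
  generalize ((Real.sqrt 2 : ℂ))⁻¹ = s at hs hc
  fin_cases x <;> fin_cases y <;>
    simp [dotProduct, Fin.sum_univ_four, hc, h2] <;>
    grind [Complex.I_sq]

theorem natCast_mul_logb_two {k : ℕ} (hk : k ≤ 2) :
    (k : ℝ) * Real.logb 2 k = ((k * (k - 1) : ℕ) : ℝ) := by
  interval_cases k <;> simp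

/-- A joint distribution with uniform marginals, all of whose entries are `0`, `1/n` or `2/n`
where `n` is the product of the sizes of the two alphabets. -/
theorem mutualInfo_of_table {X Y : Type*} [Fintype X] [Fintype Y] (k : X → Y → ℕ) (r c : ℕ)
    (hr : ∀ x, ∑ y, k x y = r) (hc : ∀ y, ∑ x, k x y = c) (hk : ∀ x y, k x y ≤ 2)
    (h : r * c ≠ 0) :
    mutualInfo (fun x y => (k x y : ℝ) / (r * c : ℕ)) =
      (∑ x, ∑ y, k x y * (k x y - 1) : ℕ) / (r * c : ℕ) := by
  have hn : ((r * c : ℕ) : ℝ) ≠ 0 := Nat.cast_ne_zero.mpr h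
  have hrow (x : X) : ∑ y, (k x y : ℝ) / (r * c : ℕ) = r / (r * c : ℕ) := by
    rw [← Finset.sum_div, ← Nat.cast_sum, hr]
  have hcol (y : Y) : ∑ x, (k x y : ℝ) / (r * c : ℕ) = c / (r * c : ℕ) := by
    rw [← Finset.sum_div, ← Nat.cast_sum, hc]
  simp only [mutualInfo, hrow, hcol]
  rw [Nat.cast_sum, Finset.sum_div]
  refine Finset.sum_congr rfl fun x _ => ?_
  rw [Nat.cast_sum, Finset.sum_div]
  refine Finset.sum_congr rfl fun y _ => ?_
  have hlog : (k x y : ℝ) / (r * c : ℕ) / (r / (r * c : ℕ) * (c / (r * c : ℕ))) = k x y := by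
    rw [div_mul_div_comm, ← Nat.cast_mul]
    field_simp
  rw [hlog, div_mul_eq_mul_div, natCast_mul_logb_two (hk x y)]

/-- Mutual information of the 4-dimensional 5-MUB ensemble `E = {(1/20)|φ_x⟩⟨φ_x|}`
measured with the orthonormal POVM `Q = {|q_y⟩⟨q_y|}`, and of the orthonormal ensemble
`F = {(1/4)|q_y⟩⟨q_y|}` measured with the 5-MUB POVM `P = {(1/5)|φ_x⟩⟨φ_x|}`:
both equal exactly `3/5` bits. -/
theorem mub4_mutual_info :
    mutualInfo (fun x y =>
        (((1 / 20 : ℂ) • outerProd (mub4Vecs x)) * outerProd (ortho4Vecs y)).trace.re)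
      = 3 / 5 ∧
    mutualInfo (fun y x =>
        (((1 / 4 : ℂ) • outerProd (ortho4Vecs y)) *
          ((1 / 5 : ℂ) • outerProd (mub4Vecs x))).trace.re)
      = 3 / 5 := by
  have hE : (fun x y =>
      (((1 / 20 : ℂ) • outerProd (mub4Vecs x)) * outerProd (ortho4Vecs y)).trace.re) =
      fun x y => (overlapTable x y : ℝ) / (4 * 20 : ℕ) := by
    ext x y
    rw [smul_mul_assoc, Matrix.trace_smul, trace_mub4_ortho4, smul_eq_mul,
      ← Complex.ofReal_re ((overlapTable x y : ℝ) / (4 * 20 : ℕ))]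
    congr 1
    push_cast
    ring
  have hF : (fun y x =>
      (((1 / 4 : ℂ) • outerProd (ortho4Vecs y)) *
        ((1 / 5 : ℂ) • outerProd (mub4Vecs x))).trace.re) =
      fun y x => (overlapTable x y : ℝ) / (20 * 4 : ℕ) := by
    ext y x
    rw [smul_mul_smul_comm, Matrix.trace_smul, Matrix.trace_mul_comm, trace_mub4_ortho4,
      smul_eq_mul, ← Complex.ofReal_re ((overlapTable x y : ℝ) / (20 * 4 : ℕ))]
    congr 1
    push_cast
    ring
  have hsum : ∑ x, ∑ y, overlapTable x y * (overlapTable x y - 1) = 48 := by decide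
  constructor
  · rw [hE, mutualInfo_of_table overlapTable 4 20 (by decide) (by decide) (by decide)
      (by norm_num), hsum]
    norm_num
  · rw [hF, mutualInfo_of_table (fun y x => overlapTable x y) 20 4 (by decide) (by decide)
      (by decide) (by norm_num), Finset.sum_comm, hsum]
    norm_num
end
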